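/- Assume (φ₀,φ₁) ≢ 0. Then for every (s,θ) with s < M, θ ∈ [0,2π], and every τ with 0 ≤ τ < τ₀, the Jacobian of the characteristic flow is positive: if F₁(s,θ) ≠ 0 then exp(−τ F₁(s,θ))·(1 + F₂(s,θ)/F₁(s,θ)) − F₂(s,θ)/F₁(s,θ) > 0, and if F₁(s,θ) = 0 then 1 − τ F₂(s,θ) > 0. -/

import Mathlib

open Real MeasureTheory Filter Topology Asymptotics

noncomputable section

/-- Partial derivative in the `i`-th coordinate direction on `Fin 3 → ℝ`
(coordinates `y = (t, x₁, x₂)`). -/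
def pd (i : Fin 3) (f : (Fin 3 → ℝ) → ℝ) : (Fin 3 → ℝ) → ℝ :=
  fun y => fderiv ℝ f y (Pi.single i 1)

/-- Radon transform of `v : ℝ² → ℝ` over the line `x · ω = s`, where
`ω = (cos θ, sin θ)`. -/
def radon (v : ℝ × ℝ → ℝ) (s θ : ℝ) : ℝ :=
  ∫ t : ℝ, v (s * Real.cos θ - t * Real.sin θ, s * Real.sin θ + t * Real.cos θ)

/-- `ω̂ = (-1, cos θ, sin θ)`. -/
def omegaHat (θ : ℝ) : Fin 3 → ℝ := ![(-1 : ℝ), Real.cos θ, Real.sin θ]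

/-- The Friedlander radiation field `F₀` associated with the data `(φ₀, φ₁)`. -/
def F0 (φ0 φ1 : ℝ × ℝ → ℝ) (σ θ : ℝ) : ℝ :=
  (1 / (2 * Real.pi * Real.sqrt 2)) *
    ∫ s in Set.Ioi σ,
      (radon φ1 s θ - deriv (fun s' => radon φ0 s' θ) s) / Real.sqrt (s - σ)

/-- `F₁(σ,θ) = (Σ d_ij ω̂_i ω̂_j) ∂_σ F₀(σ,θ)`. -/
def F1 (d : Fin 3 → Fin 3 → ℝ) (φ0 φ1 : ℝ × ℝ → ℝ) (σ θ : ℝ) : ℝ :=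
  (∑ i : Fin 3, ∑ j : Fin 3, d i j * omegaHat θ i * omegaHat θ j) *
    deriv (fun σ' => F0 φ0 φ1 σ' θ) σ

/-- `F₂(σ,θ) = (Σ e_ij^k ω̂_i ω̂_j ω̂_k) ∂²_σ F₀(σ,θ)`. -/
def F2 (e : Fin 3 → Fin 3 → Fin 3 → ℝ) (φ0 φ1 : ℝ × ℝ → ℝ) (σ θ : ℝ) : ℝ :=
  (∑ i : Fin 3, ∑ j : Fin 3, ∑ k : Fin 3,
      e i j k * omegaHat θ i * omegaHat θ j * omegaHat θ k) *
    deriv (fun σ' => deriv (fun σ'' => F0 φ0 φ1 σ'' θ) σ') σ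

/-- `G₀(σ,θ) = (1/F₁) log(1 + F₁/F₂)`. -/
def G0 (d : Fin 3 → Fin 3 → ℝ) (e : Fin 3 → Fin 3 → Fin 3 → ℝ)
    (φ0 φ1 : ℝ × ℝ → ℝ) (σ θ : ℝ) : ℝ :=
  (1 / F1 d φ0 φ1 σ θ) * Real.log (1 + F1 d φ0 φ1 σ θ / F2 e φ0 φ1 σ θ)

/-- The set `A`. -/
def setA (M : ℝ) (d : Fin 3 → Fin 3 → ℝ) (e : Fin 3 → Fin 3 → Fin 3 → ℝ)
    (φ0 φ1 : ℝ × ℝ → ℝ) : Set (ℝ × ℝ) :=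
  {p | p.1 < M ∧ p.2 ∈ Set.Icc 0 (2 * Real.pi) ∧
    F1 d φ0 φ1 p.1 p.2 ≠ 0 ∧ F2 e φ0 φ1 p.1 p.2 ≠ 0 ∧
    0 < 1 + F1 d φ0 φ1 p.1 p.2 / F2 e φ0 φ1 p.1 p.2}

/-- The set `B = {(σ,θ) ∈ A : G₀(σ,θ) > 0}`. -/
def setB (M : ℝ) (d : Fin 3 → Fin 3 → ℝ) (e : Fin 3 → Fin 3 → Fin 3 → ℝ)
    (φ0 φ1 : ℝ × ℝ → ℝ) : Set (ℝ × ℝ) :=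
  {p ∈ setA M d e φ0 φ1 | 0 < G0 d e φ0 φ1 p.1 p.2}

/-- `τ₀ = inf_{(σ,θ) ∈ B} G₀(σ,θ)`. -/
def tau0 (M : ℝ) (d : Fin 3 → Fin 3 → ℝ) (e : Fin 3 → Fin 3 → Fin 3 → ℝ)
    (φ0 φ1 : ℝ × ℝ → ℝ) : ℝ :=
  sInf ((fun p : ℝ × ℝ => G0 d e φ0 φ1 p.1 p.2) '' setB M d e φ0 φ1)

/-- The set `D = {(σ,θ) : σ < M, F₁ = 0, F₂ > 0}`. -/
def setD (M : ℝ) (d : Fin 3 → Fin 3 → ℝ) (e : Fin 3 → Fin 3 → Fin 3 → ℝ)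
    (φ0 φ1 : ℝ × ℝ → ℝ) : Set (ℝ × ℝ) :=
  {p | p.1 < M ∧ p.2 ∈ Set.Icc 0 (2 * Real.pi) ∧
    F1 d φ0 φ1 p.1 p.2 = 0 ∧ 0 < F2 e φ0 φ1 p.1 p.2}

/-- `φ` is supported in the closed disk of radius `M` centered at the origin. -/
def SuppIn (M : ℝ) (φ : ℝ × ℝ → ℝ) : Prop :=
  ∀ x : ℝ × ℝ, M ^ 2 < x.1 ^ 2 + x.2 ^ 2 → φ x = 0

/-- The cubic form `Σ e_ij^k ξ_i ξ_j ξ_k` does not satisfy the null condition: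
it does not vanish identically on the light cone. -/
def NullCondFails (e : Fin 3 → Fin 3 → Fin 3 → ℝ) : Prop :=
  ∃ ξ : Fin 3 → ℝ, ξ 0 ^ 2 = ξ 1 ^ 2 + ξ 2 ^ 2 ∧ (ξ 1 ≠ 0 ∨ ξ 2 ≠ 0) ∧
    (∑ i : Fin 3, ∑ j : Fin 3, ∑ k : Fin 3, e i j k * ξ i * ξ j * ξ k) ≠ 0

/-- Hessian (as a 2×2 matrix) of a function of two real variables. -/
def hessCurried (f : ℝ → ℝ → ℝ) (σ θ : ℝ) : Matrix (Fin 2) (Fin 2) ℝ :=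
  !![deriv (fun a => deriv (fun b => f b θ) a) σ,
     deriv (fun a => deriv (fun b => f a b) θ) σ;
     deriv (fun b => deriv (fun a => f a b) σ) θ,
     deriv (fun b => deriv (fun b' => f σ b') b) θ]

/-- Minkowski coefficients: `Σ c_ij ∂_ij = ∂_t² - Δ`. -/
def cMink : Fin 3 → Fin 3 → ℝ := fun i j =>
  if i = j then (if i = 0 then 1 else -1) else 0

/-- `u` is a `C^∞` solution of problem (1.1) on `[0,T) × ℝ²`. -/
def IsSol (g : Fin 3 → Fin 3 → ℝ → (Fin 3 → ℝ) → ℝ) (ε : ℝ)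
    (φ0 φ1 : ℝ × ℝ → ℝ) (u : (Fin 3 → ℝ) → ℝ) (T : ℝ) : Prop :=
  ContDiffOn ℝ (⊤ : ℕ∞) u {y | 0 ≤ y 0 ∧ y 0 < T} ∧
  (∀ y : Fin 3 → ℝ, 0 ≤ y 0 → y 0 < T →
    ∑ i : Fin 3, ∑ j : Fin 3,
      g i j (u y) (fun k => pd k u y) * pd i (pd j u) y = 0) ∧
  (∀ x : ℝ × ℝ, u ![0, x.1, x.2] = ε * φ0 x ∧ pd 0 u ![0, x.1, x.2] = ε * φ1 x)

/-- The lifespan `T_ε`: the supremum of times of existence of smooth solutions. -/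
def lifespan (g : Fin 3 → Fin 3 → ℝ → (Fin 3 → ℝ) → ℝ) (ε : ℝ)
    (φ0 φ1 : ℝ × ℝ → ℝ) : ℝ :=
  sSup {T : ℝ | ∃ u, IsSol g ε φ0 φ1 u T}

/-- `V` is a `C^∞` solution of the profile problem (2.1) on `ℝ × S¹ × [0, τmax)`. -/
def IsProfileSol (M : ℝ) (d : Fin 3 → Fin 3 → ℝ) (e : Fin 3 → Fin 3 → Fin 3 → ℝ)
    (φ0 φ1 : ℝ × ℝ → ℝ) (τmax : ℝ) (V : ℝ → ℝ → ℝ → ℝ) : Prop :=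
  ContDiffOn ℝ (⊤ : ℕ∞) (fun p : ℝ × ℝ × ℝ => V p.1 p.2.1 p.2.2)
    {p : ℝ × ℝ × ℝ | 0 ≤ p.2.2 ∧ p.2.2 < τmax} ∧
  (∀ q θ τ : ℝ, V q (θ + 2 * Real.pi) τ = V q θ τ) ∧
  (∀ q θ τ : ℝ, M < q → V q θ τ = 0) ∧
  (∀ q θ : ℝ, V q θ 0 = F0 φ0 φ1 q θ) ∧
  (∀ q θ τ : ℝ, 0 ≤ τ → τ < τmax →
    deriv (fun τ' => deriv (fun q' => V q' θ τ') q) τ -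
      ∑ i : Fin 3, ∑ j : Fin 3,
        (d i j * V q θ τ +
          ∑ k : Fin 3, e i j k * omegaHat θ k * deriv (fun q' => V q' θ τ) q) *
        omegaHat θ i * omegaHat θ j *
        deriv (fun q' => deriv (fun q'' => V q'' θ τ) q') q = 0)

/-- The Jacobian `∂_s q` of the characteristic flow. -/
def kfun (d : Fin 3 → Fin 3 → ℝ) (e : Fin 3 → Fin 3 → Fin 3 → ℝ)
    (φ0 φ1 : ℝ × ℝ → ℝ) (ρ θ τ : ℝ) : ℝ :=
  if F1 d φ0 φ1 ρ θ = 0 then 1 - τ * F2 e φ0 φ1 ρ θ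
  else Real.exp (-τ * F1 d φ0 φ1 ρ θ) * (1 + F2 e φ0 φ1 ρ θ / F1 d φ0 φ1 ρ θ)
        - F2 e φ0 φ1 ρ θ / F1 d φ0 φ1 ρ θ

/-- Partial derivatives on `ℝ × ℝ × ℝ` (coordinates `(s, θ, τ)`). -/
def pd3 : Fin 3 → (ℝ × ℝ × ℝ → ℝ) → ℝ × ℝ × ℝ → ℝ :=
  ![fun f p => deriv (fun a => f (a, p.2.1, p.2.2)) p.1,
    fun f p => deriv (fun a => f (p.1, a, p.2.2)) p.2.1,
    fun f p => deriv (fun a => f (p.1, p.2.1, a)) p.2.2]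

/-- Hessian in the first two variables `(s, θ)` of a function on `ℝ × ℝ × ℝ`. -/
def hessST (f : ℝ × ℝ × ℝ → ℝ) (p : ℝ × ℝ × ℝ) : Matrix (Fin 2) (Fin 2) ℝ :=
  !![pd3 0 (pd3 0 f) p, pd3 0 (pd3 1 f) p;
     pd3 1 (pd3 0 f) p, pd3 1 (pd3 1 f) p]

/-- The Klainerman vector fields on `ℝ_t × ℝ²`:
`∂_t, ∂_1, ∂_2, S = t∂_t + x₁∂_1 + x₂∂_2, H₁, H₂, R`. -/
def KOp : Fin 7 → ((Fin 3 → ℝ) → ℝ) → (Fin 3 → ℝ) → ℝ :=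
  ![fun f => pd 0 f,
    fun f => pd 1 f,
    fun f => pd 2 f,
    fun f y => y 0 * pd 0 f y + y 1 * pd 1 f y + y 2 * pd 2 f y,
    fun f y => y 1 * pd 0 f y + y 0 * pd 1 f y,
    fun f y => y 2 * pd 0 f y + y 0 * pd 2 f y,
    fun f y => y 1 * pd 2 f y - y 2 * pd 1 f y]

/-- `Z^α`: iterated product of Klainerman vector fields indexed by a list. -/
def Zpow (α : List (Fin 7)) (f : (Fin 3 → ℝ) → ℝ) : (Fin 3 → ℝ) → ℝ :=
  α.foldr (fun i acc => KOp i acc) f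

end

lemma contDiff_pderiv {f : ℝ → ℝ → ℝ} (hf : ContDiff ℝ (⊤ : ℕ∞) (fun p : ℝ × ℝ => f p.1 p.2)) :
    ContDiff ℝ (⊤ : ℕ∞) (fun p : ℝ × ℝ => deriv (fun s => f s p.2) p.1) := by
  have h : (fun p : ℝ × ℝ => deriv (fun s => f s p.2) p.1) =
      fun p : ℝ × ℝ => fderiv ℝ (fun p : ℝ × ℝ => f p.1 p.2) p ((1 : ℝ), (0 : ℝ)) := by
    funext p
    have h1 : HasFDerivAt (fun p : ℝ × ℝ => f p.1 p.2)
        (fderiv ℝ (fun p : ℝ × ℝ => f p.1 p.2) p) (p.1, p.2) :=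
      ((hf.differentiable (by simp)) p).hasFDerivAt
    have h2 : HasDerivAt (fun s : ℝ => (s, p.2)) ((1 : ℝ), (0 : ℝ)) p.1 :=
      (hasDerivAt_id p.1).prodMk (hasDerivAt_const _ _)
    exact (h1.comp_hasDerivAt p.1 h2).deriv
  rw [h]
  exact (hf.fderiv_right (m := (⊤ : ℕ∞)) (by simp)).clm_apply contDiff_const

lemma radon_contDiff {M : ℝ} (v : ℝ × ℝ → ℝ) (hv : ContDiff ℝ (⊤ : ℕ∞) v) (hs : SuppIn M v) :
    ContDiff ℝ (⊤ : ℕ∞) (fun p : ℝ × ℝ => radon v p.1 p.2) := by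
  let g : ℝ × ℝ → ℝ → ℝ := fun p x =>
    v (p.1 * Real.cos p.2 + x * Real.sin p.2, p.1 * Real.sin p.2 - x * Real.cos p.2)
  have hg : ContDiff ℝ (⊤ : ℕ∞) (Function.HasUncurry.uncurry g) := by
    change ContDiff ℝ (⊤ : ℕ∞) (fun q : (ℝ × ℝ) × ℝ =>
      v (q.1.1 * Real.cos q.1.2 + q.2 * Real.sin q.1.2,
        q.1.1 * Real.sin q.1.2 - q.2 * Real.cos q.1.2))
    fun_prop
  have key := contDiffOn_convolution_right_with_param_comp (𝕜 := ℝ) (μ := (volume : Measure ℝ))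
    (ContinuousLinearMap.lsmul ℝ ℝ) (s := (Set.univ : Set (ℝ × ℝ))) (n := (⊤ : ℕ∞))
    (v := fun _ : ℝ × ℝ => (0 : ℝ)) contDiffOn_const
    (f := fun _ : ℝ => (1 : ℝ)) (g := g) (k := Set.Icc (-|M|) |M|)
    isOpen_univ isCompact_Icc ?_ (locallyIntegrable_const 1) hg.contDiffOn
  · rw [contDiffOn_univ] at key
    convert key using 2 with p
    simp only [radon, convolution, g, ContinuousLinearMap.lsmul_apply, one_smul]
    congr 1
    funext t
    simp [sub_eq_add_neg]
  · intro p x _ hx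
    apply hs
    have hx' : |M| < |x| := by
      by_contra h
      exact hx (abs_le.mp (not_lt.mp h))
    have := sq_lt_sq.mpr hx'
    simp only
    nlinarith [Real.sin_sq_add_cos_sq p.2, sq_nonneg p.1]

lemma radon_zero {M : ℝ} (v : ℝ × ℝ → ℝ) (hs : SuppIn M v) {s θ : ℝ} (h : |M| < |s|) :
    radon v s θ = 0 := by
  unfold radon
  have : ∀ t : ℝ, v (s * Real.cos θ - t * Real.sin θ, s * Real.sin θ + t * Real.cos θ) = 0 := by
    intro t
    apply hs
    have := sq_lt_sq.mpr h
    simp only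
    nlinarith [Real.sin_sq_add_cos_sq θ, sq_nonneg t]
  simp [this]

lemma kernel_locInt : LocallyIntegrable
    (Set.indicator (Set.Iio (0 : ℝ)) (fun t => 1 / Real.sqrt (-t))) volume := by
  refine locallyIntegrable_of_norm_le_rpow (C := 1) (α := 1 / 2) (by simp) (by simp; norm_num)
    ?_ ?_
  · refine Eventually.of_forall fun t => ?_
    by_cases ht : t < 0
    · rw [Set.indicator_of_mem (Set.mem_Iio.mpr ht), Real.norm_eq_abs, Real.norm_eq_abs,
        abs_of_nonneg (by positivity), abs_of_neg ht, Real.sqrt_eq_rpow,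
        Real.rpow_neg (by linarith)]
      simp
    · rw [Set.indicator_of_notMem (by simpa using ht)]
      simp
      positivity
  · refine Measurable.aestronglyMeasurable ?_
    refine Measurable.indicator ?_ measurableSet_Iio
    fun_prop

lemma F0_contDiff {M : ℝ} (φ0 φ1 : ℝ × ℝ → ℝ)
    (hφ0 : ContDiff ℝ (⊤ : ℕ∞) φ0) (hφ1 : ContDiff ℝ (⊤ : ℕ∞) φ1)
    (hs0 : SuppIn M φ0) (hs1 : SuppIn M φ1) :
    ContDiff ℝ (⊤ : ℕ∞) (fun p : ℝ × ℝ => F0 φ0 φ1 p.1 p.2) := by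
  let h : ℝ → ℝ → ℝ := fun θ s => radon φ1 s θ - deriv (fun s' => radon φ0 s' θ) s
  have hh : ContDiff ℝ (⊤ : ℕ∞) (fun p : ℝ × ℝ => h p.2 p.1) :=
    (radon_contDiff φ1 hφ1 hs1).sub (contDiff_pderiv (radon_contDiff φ0 hφ0 hs0))
  let f := (Set.indicator (Set.Iio (0 : ℝ)) (fun t => 1 / Real.sqrt (-t)))
  let g : ℝ × ℝ → ℝ → ℝ := fun p x => h p.2 x
  have hg : ContDiff ℝ (⊤ : ℕ∞) (Function.HasUncurry.uncurry g) := by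
    change ContDiff ℝ (⊤ : ℕ∞) (fun q : (ℝ × ℝ) × ℝ => h q.1.2 q.2)
    exact hh.comp (contDiff_snd.prodMk (contDiff_snd.comp contDiff_fst))
  have key := contDiffOn_convolution_right_with_param_comp (𝕜 := ℝ) (μ := (volume : Measure ℝ))
    (ContinuousLinearMap.lsmul ℝ ℝ) (s := (Set.univ : Set (ℝ × ℝ))) (n := (⊤ : ℕ∞))
    (v := fun p : ℝ × ℝ => p.1) contDiffOn_fst
    (f := f) (g := g) (k := Set.Icc (-|M|) |M|)
    isOpen_univ isCompact_Icc ?_ kernel_locInt hg.contDiffOn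
  · rw [contDiffOn_univ] at key
    have key2 := (contDiff_const (c := 1 / (2 * Real.pi * Real.sqrt 2))).mul key
    refine Eq.subst (motive := fun u => ContDiff ℝ (⊤ : ℕ∞) u) (funext fun p => ?_) key2
    symm
    unfold F0
    congr 1
    rw [← integral_indicator measurableSet_Ioi]
    simp only [convolution, ContinuousLinearMap.lsmul_apply, smul_eq_mul]
    rw [← integral_sub_left_eq_self _ volume p.1]
    congr 1
    funext t
    by_cases ht : t < 0
    · have h1 : p.1 - t ∈ Set.Ioi p.1 := Set.mem_Ioi.mpr (by linarith)
      rw [Set.indicator_of_mem h1]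
      simp only [f, g, h]
      rw [Set.indicator_of_mem (Set.mem_Iio.mpr ht)]
      have : p.1 - t - p.1 = -t := by ring
      rw [this]; ring
    · have h1 : p.1 - t ∉ Set.Ioi p.1 := fun h => ht (by linarith [Set.mem_Ioi.mp h])
      rw [Set.indicator_of_notMem h1]
      simp only [f]
      rw [Set.indicator_of_notMem (by simpa using ht)]
      simp
  · intro p x _ hx
    have hx' : |M| < |x| := by
      by_contra h
      exact hx (abs_le.mp (not_lt.mp h))
    have hev : (fun s' => radon φ0 s' p.2) =ᶠ[𝓝 x] fun _ => 0 := by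
      have : ∀ᶠ y in 𝓝 x, |M| < |y| := continuous_abs.continuousAt.eventually (lt_mem_nhds hx')
      filter_upwards [this] with y hy using radon_zero φ0 hs0 hy
    simp only [g, h]
    rw [radon_zero φ1 hs1 hx', hev.deriv_eq]
    simp

lemma jac_pos_of_ne {M : ℝ} {φ0 φ1 : ℝ × ℝ → ℝ} {d : Fin 3 → Fin 3 → ℝ}
    {e : Fin 3 → Fin 3 → Fin 3 → ℝ} {s θ τ : ℝ} (hs : s < M)
    (hθ : θ ∈ Set.Icc 0 (2 * Real.pi)) (hτ : 0 ≤ τ) (hτ0 : τ < tau0 M d e φ0 φ1)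
    (hF : F1 d φ0 φ1 s θ ≠ 0) :
    0 < Real.exp (-τ * F1 d φ0 φ1 s θ) *
              (1 + F2 e φ0 φ1 s θ / F1 d φ0 φ1 s θ)
            - F2 e φ0 φ1 s θ / F1 d φ0 φ1 s θ := by
  have hB : ∀ p ∈ setB M d e φ0 φ1, τ < G0 d e φ0 φ1 p.1 p.2 := by
    intro p hp
    refine lt_of_lt_of_le hτ0 (csInf_le ⟨0, ?_⟩ ⟨p, hp, rfl⟩)
    rintro _ ⟨q, hq, rfl⟩
    exact hq.2.le
  have hG := hB (s, θ)
  simp only [setB, setA, G0, Set.mem_ofPred_eq] at hG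
  set a := F1 d φ0 φ1 s θ
  set b := F2 e φ0 φ1 s θ
  by_cases hb : b = 0
  · simp only [hb]; simp; exact Real.exp_pos _
  have hE := Real.exp_pos (-τ * a)
  set E := Real.exp (-τ * a) with hEdef
  have hid : E * (1 + b / a) - b / a = (E * (a + b) - b) / a := by field_simp
  rw [hid]
  by_cases hab : 0 < 1 + a / b
  · -- τ is not a zero and lies on the right side
    have hexp : ∀ x : ℝ, x < Real.log (1 + a / b) → Real.exp x < 1 + a / b := fun x hx => by
      rwa [← Real.lt_log_iff_exp_lt hab]
    have hexp' : ∀ x : ℝ, Real.log (1 + a / b) < x → 1 + a / b < Real.exp x := fun x hx => by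
      rwa [← Real.log_lt_iff_lt_exp hab]
    have hEE : E * Real.exp (τ * a) = 1 := by
      rw [hEdef, ← Real.exp_add]; simp
    have hfac : E * (a + b) - b = b * E * ((1 + a / b) - Real.exp (τ * a)) := by
      have : b * E * ((1 + a / b) - Real.exp (τ * a))
        = E * (a + b) - b * (E * Real.exp (τ * a)) := by field_simp; ring
      rw [this, hEE]; ring
    have hlt : 0 < 1 / a * Real.log (1 + a / b) → τ < 1 / a * Real.log (1 + a / b) :=
      fun h => hG ⟨⟨hs, hθ, hF, hb, hab⟩, h⟩
    rw [hfac]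
    rcases lt_or_gt_of_ne hF with ha | ha
    · rcases lt_or_gt_of_ne hb with hb' | hb'
      · have h1 : 0 < a / b := div_pos_of_neg_of_neg ha hb'
        have h2 : Real.exp (τ * a) ≤ 1 := Real.exp_le_one_iff.mpr (by nlinarith)
        apply div_pos_of_neg_of_neg _ ha
        apply mul_neg_of_neg_of_pos (mul_neg_of_neg_of_pos hb' hE); linarith
      · have h1 : a / b < 0 := div_neg_of_neg_of_pos ha hb'
        have h2 : Real.log (1 + a / b) < 0 := Real.log_neg hab (by linarith)
        have h3 := hlt (mul_pos_of_neg_of_neg (one_div_neg.mpr ha) h2)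
        have h4 : Real.log (1 + a / b) < τ * a := by
          rw [one_div_mul_eq_div, lt_div_iff_of_neg ha] at h3; exact h3
        have h5 := hexp' _ h4
        apply div_pos_of_neg_of_neg _ ha
        apply mul_neg_of_pos_of_neg (mul_pos hb' hE); linarith
    · rcases lt_or_gt_of_ne hb with hb' | hb'
      · have h1 : a / b < 0 := div_neg_of_pos_of_neg ha hb'
        have h2 : 1 ≤ Real.exp (τ * a) := Real.one_le_exp (by positivity)
        apply div_pos _ ha
        apply mul_pos_of_neg_of_neg (mul_neg_of_neg_of_pos hb' hE); linarith
      · have h1 : 0 < a / b := div_pos ha hb'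
        have h2 : 0 < Real.log (1 + a / b) := Real.log_pos (by linarith)
        have h3 := hlt (mul_pos (one_div_pos.mpr ha) h2)
        have h4 : τ * a < Real.log (1 + a / b) := by
          rw [one_div_mul_eq_div, lt_div_iff₀ ha] at h3; exact h3
        have h5 := hexp _ h4
        apply div_pos _ ha
        apply mul_pos (mul_pos hb' hE); linarith
  · have h1 : 1 + a / b ≤ 0 := not_lt.mp hab
    have h2 : a + b = b * (1 + a / b) := by field_simp; ring
    rcases lt_or_gt_of_ne hb with hb' | hb'
    · have ha : 0 < a := by
        by_contra h
        have := div_nonneg_of_nonpos (not_lt.mp h) hb'.le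
        linarith
      have h3 : 0 ≤ a + b := by rw [h2]; exact mul_nonneg_of_nonpos_of_nonpos hb'.le h1
      apply div_pos _ ha
      have := mul_nonneg hE.le h3
      linarith
    · have ha : a < 0 := by
        by_contra h
        have := div_nonneg (not_lt.mp h) hb'.le
        linarith
      have h3 : a + b ≤ 0 := by rw [h2]; exact mul_nonpos_of_nonneg_of_nonpos hb'.le h1
      apply div_pos_of_neg_of_neg _ ha
      have := mul_nonpos_of_nonneg_of_nonpos hE.le h3
      linarith

lemma bound_of_pos {a b τ : ℝ} (ha : a ≠ 0) (hτ : 0 ≤ τ)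
    (h : 0 < Real.exp (-τ * a) * (1 + b / a) - b / a) : τ * b ≤ Real.exp (τ * |a|) := by
  have h1 : 1 ≤ Real.exp (τ * |a|) := Real.one_le_exp (by positivity)
  rcases le_or_gt b 0 with hb | hb
  · have := mul_nonpos_of_nonneg_of_nonpos hτ hb
    linarith
  have hE := Real.exp_pos (-τ * a)
  have hid : Real.exp (-τ * a) * (1 + b / a) - b / a
    = Real.exp (-τ * a) - b * ((1 - Real.exp (-τ * a)) / a) := by field_simp; ring
  rw [hid] at h
  rcases lt_or_gt_of_ne ha with ha | ha
  · have h2 : τ ≤ (1 - Real.exp (-τ * a)) / a := by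
      rw [le_div_iff_of_neg ha]
      have := Real.add_one_le_exp (-τ * a)
      linarith
    have h3 := mul_le_mul_of_nonneg_left h2 hb.le
    rw [abs_of_neg ha]
    have : τ * -a = -τ * a := by ring
    rw [this]
    linarith
  · have h2 : τ * Real.exp (-τ * a) ≤ (1 - Real.exp (-τ * a)) / a := by
      rw [le_div_iff₀ ha]
      have h4 := Real.add_one_le_exp (τ * a)
      have h5 : Real.exp (-τ * a) * Real.exp (τ * a) = 1 := by
        rw [← Real.exp_add]; simp
      have := mul_le_mul_of_nonneg_left h4 hE.le
      nlinarith
    have h3 := mul_le_mul_of_nonneg_left h2 hb.le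
    have h6 : 0 < (1 - τ * b) * Real.exp (-τ * a) := by nlinarith
    have := pos_of_mul_pos_left h6 hE.le
    linarith

lemma dform_dense (d : Fin 3 → Fin 3 → ℝ)
    (hdsymm : ∀ i j, d i j = d j i) (hd00 : d 0 0 = 0)
    (hdne : ∃ i j : Fin 3, (i, j) ≠ ((0 : Fin 3), (0 : Fin 3)) ∧ d i j ≠ 0)
    {θ : ℝ} (hθ : θ ∈ Set.Icc 0 (2 * Real.pi)) {U : Set ℝ} (hU : IsOpen U) (hθU : θ ∈ U) :
    ∃ θ' ∈ U, θ' ∈ Set.Icc 0 (2 * Real.pi) ∧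
      (∑ i : Fin 3, ∑ j : Fin 3, d i j * omegaHat θ' i * omegaHat θ' j) ≠ 0 := by
  by_contra! hcon
  let f : ℝ → ℝ := fun t => ∑ i : Fin 3, ∑ j : Fin 3, d i j * omegaHat t i * omegaHat t j
  have hf : ∀ t, f t = -2 * d 0 1 * Real.cos t - 2 * d 0 2 * Real.sin t + d 1 1 * Real.cos t ^ 2
      + 2 * d 1 2 * Real.cos t * Real.sin t + d 2 2 * Real.sin t ^ 2 := by
    intro t
    simp only [f, omegaHat, Fin.sum_univ_three]
    simp [hd00, hdsymm 1 0, hdsymm 2 0, hdsymm 2 1]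
    ring
  have hpi : (0 : ℝ) < 2 * Real.pi := by positivity
  have hcl : θ ∈ closure (Set.Ioo 0 (2 * Real.pi)) := by rwa [closure_Ioo hpi.ne]
  obtain ⟨t1, ht1U, ht1⟩ := mem_closure_iff.mp hcl U hU hθU
  have hev : f =ᶠ[𝓝 t1] 0 := by
    filter_upwards [hU.mem_nhds ht1U, isOpen_Ioo.mem_nhds ht1] with t h1 h2
    exact hcon t h1 (Set.Ioo_subset_Icc_self h2)
  have han : AnalyticOnNhd ℝ f Set.univ := by
    have : f = fun t => -2 * d 0 1 * Real.cos t - 2 * d 0 2 * Real.sin t + d 1 1 * Real.cos t ^ 2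
      + 2 * d 1 2 * Real.cos t * Real.sin t + d 2 2 * Real.sin t ^ 2 := funext hf
    rw [this]
    intro t _
    fun_prop
  have hz : ∀ t, f t = 0 := fun t =>
    han.eqOn_zero_of_preconnected_of_eventuallyEq_zero isPreconnected_univ (Set.mem_univ t1) hev
      (Set.mem_univ t)
  have e0 := hz 0
  have e1 := hz Real.pi
  have e2 := hz (Real.pi / 2)
  have e3 := hz (-(Real.pi / 2))
  have e4 := hz (Real.pi / 4)
  rw [hf] at e0 e1 e2 e3 e4
  simp only [Real.cos_neg, Real.sin_neg, Real.cos_pi_div_two, Real.sin_pi_div_two,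
    Real.cos_zero, Real.sin_zero, Real.cos_pi, Real.sin_pi] at e0 e1 e2 e3
  have d01 : d 0 1 = 0 := by linarith
  have d11 : d 1 1 = 0 := by linarith
  have d02 : d 0 2 = 0 := by linarith
  have d22 : d 2 2 = 0 := by linarith
  have d12 : d 1 2 = 0 := by
    rw [d01, d11, d02, d22, Real.cos_pi_div_four, Real.sin_pi_div_four] at e4
    have : Real.sqrt 2 * Real.sqrt 2 = 2 := Real.mul_self_sqrt (by norm_num)
    nlinarith
  obtain ⟨i, j, -, hij⟩ := hdne
  apply hij
  fin_cases i <;> fin_cases j <;> simp [hd00, d01, d02, d11, d12, d22, hdsymm 1 0, hdsymm 2 0,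
    hdsymm 2 1]

/-- Positivity of the Jacobian of the characteristic flow for `0 ≤ τ < τ₀`. -/
theorem characteristic_jacobian_pos
    (M : ℝ) (hM : 0 < M)
    (φ0 φ1 : ℝ × ℝ → ℝ)
    (hφ0 : ContDiff ℝ (⊤ : ℕ∞) φ0) (hφ1 : ContDiff ℝ (⊤ : ℕ∞) φ1)
    (hs0 : SuppIn M φ0) (hs1 : SuppIn M φ1)
    (d : Fin 3 → Fin 3 → ℝ)
    (hdsymm : ∀ i j, d i j = d j i) (hd00 : d 0 0 = 0)
    (hdne : ∃ i j : Fin 3, (i, j) ≠ ((0 : Fin 3), (0 : Fin 3)) ∧ d i j ≠ 0)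
    (e : Fin 3 → Fin 3 → Fin 3 → ℝ)
    (hnull : NullCondFails e)
    (hne : φ0 ≠ 0 ∨ φ1 ≠ 0) :
    ∀ s θ τ : ℝ, s < M → θ ∈ Set.Icc 0 (2 * Real.pi) → 0 ≤ τ →
      τ < tau0 M d e φ0 φ1 →
      (F1 d φ0 φ1 s θ ≠ 0 →
        0 < Real.exp (-τ * F1 d φ0 φ1 s θ) *
              (1 + F2 e φ0 φ1 s θ / F1 d φ0 φ1 s θ)
            - F2 e φ0 φ1 s θ / F1 d φ0 φ1 s θ) ∧
      (F1 d φ0 φ1 s θ = 0 → 0 < 1 - τ * F2 e φ0 φ1 s θ) := by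
  intro s θ τ hs hθ hτ hτ0
  refine ⟨fun hF => jac_pos_of_ne hs hθ hτ hτ0 hF, fun hF => ?_⟩
  rcases le_or_gt (F2 e φ0 φ1 s θ) 0 with hb | hb
  · have := mul_nonpos_of_nonneg_of_nonpos hτ hb
    linarith
  obtain ⟨τ', h1, h2⟩ := exists_between hτ0
  have hτ' : 0 ≤ τ' := hτ.trans h1.le
  have c0 := F0_contDiff φ0 φ1 hφ0 hφ1 hs0 hs1
  have c1 := contDiff_pderiv c0
  have c2 := contDiff_pderiv (f := fun a b => deriv (fun σ' => F0 φ0 φ1 σ' b) a) c1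
  have ho : ∀ i, Continuous (fun t : ℝ => omegaHat t i) := by
    intro i
    fin_cases i <;> simp [omegaHat] <;> fun_prop
  have k1 : Continuous (fun p : ℝ × ℝ => F1 d φ0 φ1 p.1 p.2) := by
    unfold F1
    refine Continuous.mul ?_ c1.continuous
    have := fun i => (ho i).comp (continuous_snd (X := ℝ) (Y := ℝ))
    simp only [Function.comp_def] at this
    fun_prop
  have k2 : Continuous (fun p : ℝ × ℝ => F2 e φ0 φ1 p.1 p.2) := by
    unfold F2
    refine Continuous.mul ?_ c2.continuous
    have := fun i => (ho i).comp (continuous_snd (X := ℝ) (Y := ℝ))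
    simp only [Function.comp_def] at this
    fun_prop
  let S : Set (ℝ × ℝ) := {p | p.1 < M ∧ p.2 ∈ Set.Icc 0 (2 * Real.pi) ∧ F1 d φ0 φ1 p.1 p.2 ≠ 0}
  have hcl : (s, θ) ∈ _root_.closure (X := ℝ × ℝ) S := by
    refine _root_.mem_closure_iff.mpr fun O hO hmem => ?_
    have hne2 : deriv (fun σ' => deriv (fun σ'' => F0 φ0 φ1 σ'' θ) σ') s ≠ 0 := by
      intro h0
      rw [F2, h0, mul_zero] at hb
      exact lt_irrefl _ hb
    have hnhds : O ∩ {p : ℝ × ℝ | p.1 < M} ∩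
        {p : ℝ × ℝ | deriv (fun σ' => deriv (fun σ'' => F0 φ0 φ1 σ'' p.2) σ') p.1 ≠ 0}
        ∈ 𝓝 (s, θ) := by
      refine IsOpen.mem_nhds ((hO.inter (isOpen_lt continuous_fst continuous_const)).inter
        (isOpen_ne_fun c2.continuous continuous_const)) ⟨⟨hmem, hs⟩, hne2⟩
    rw [nhds_prod_eq] at hnhds
    obtain ⟨I, hI, J, hJ, hIJ⟩ := mem_prod_iff.mp hnhds
    obtain ⟨J', hJ'J, hJ'o, hθJ'⟩ := mem_nhds_iff.mp hJ
    obtain ⟨θ', hθ'J, hθ'I, hD⟩ := dform_dense d hdsymm hd00 hdne hθ hJ'o hθJ'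
    have hn : deriv (fun σ' => deriv (fun σ'' => F0 φ0 φ1 σ'' θ') σ') s ≠ 0 :=
      (hIJ (Set.mk_mem_prod (mem_of_mem_nhds hI) (hJ'J hθ'J))).2
    have hex : ∃ s' ∈ I, deriv (fun σ'' => F0 φ0 φ1 σ'' θ') s' ≠ 0 := by
      by_contra! hcon
      apply hn
      have hev : (fun σ' => deriv (fun σ'' => F0 φ0 φ1 σ'' θ') σ') =ᶠ[𝓝 s] fun _ => 0 := by
        filter_upwards [hI] with x hx using hcon x hx
      rw [hev.deriv_eq]; simp
    obtain ⟨s', hs'I, hs'⟩ := hex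
    have hm := hIJ (Set.mk_mem_prod hs'I (hJ'J hθ'J))
    exact ⟨(s', θ'), hm.1.1, hm.1.2, hθ'I, mul_ne_zero hD hs'⟩
  have hle : τ' * F2 e φ0 φ1 s θ ≤ Real.exp (τ' * |F1 d φ0 φ1 s θ|) := by
    have g1 : Continuous (fun p : ℝ × ℝ => τ' * F2 e φ0 φ1 p.1 p.2) := continuous_const.mul k2
    have g2 : Continuous (fun p : ℝ × ℝ => Real.exp (τ' * |F1 d φ0 φ1 p.1 p.2|)) :=
      Real.continuous_exp.comp (continuous_const.mul k1.abs)
    have hsub : S ⊆ {p : ℝ × ℝ | τ' * F2 e φ0 φ1 p.1 p.2 ≤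
        Real.exp (τ' * |F1 d φ0 φ1 p.1 p.2|)} := by
      rintro p ⟨hp1, hp2, hp3⟩
      exact bound_of_pos hp3 hτ' (jac_pos_of_ne hp1 hp2 hτ' h2 hp3)
    have hc := closure_minimal hsub (isClosed_le g1 g2)
    have hm := hc hcl
    rw [Set.mem_ofPred_eq] at hm
    exact hm
  rw [hF] at hle
  simp at hle
  have := mul_lt_mul_of_pos_right h1 hb
  linarith
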